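/- arXiv:1107.3516 — 6 statements merged into one kernel-verified Lean document; each statement's English description precedes it below -/
import Mathlib

section
/- Let K be a field and let φ : K[z₁₁, z₁₂, …, z₃₃] → K[x₁,x₂,x₃,y₁,y₂,y₃] be the K-algebra homomorphism determined by zᵢⱼ ↦ xᵢ·yⱼ (i, j ∈ {1,2,3}). Then: (a) a homogeneous polynomial q of degree 2 in the zᵢⱼ satisfies φ(q) = 0 if and only if q lies in the K-linear span of the 2×2 minors zᵢⱼ·z_{kl} − z_{il}·z_{kj} (i,j,k,l ∈ {1,2,3}); and (b) every polynomial in the xᵢ and yⱼ that is bihomogeneous of bidegree (2,2) (homogeneous of degree 2 in x₁,x₂,x₃ and of degree 2 in y₁,y₂,y₃) equals φ(q) for some homogeneous polynomial q of degree 2 in the zᵢⱼ. -/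
open MvPolynomial

section Segre

variable {σ τ K : Type*}

/-- An exponent vector of degree two is the sum of two unit vectors. -/
theorem exists_eq_single_add_single_of_weight_one_eq_two {e : σ →₀ ℕ}
    (he : Finsupp.weight (1 : σ → ℕ) e = 2) :
    ∃ a b, e = Finsupp.single a 1 + Finsupp.single b 1 := by
  classical
  have hcard : (Finsupp.toMultiset e).card = 2 := by
    rw [Finsupp.card_toMultiset, ← he, Finsupp.weight_apply]
    simp [Finsupp.sum]
  obtain ⟨a, b, hab⟩ := Multiset.card_eq_two.mp hcard
  refine ⟨a, b, Multiset.toFinsupp.symm.injective ?_⟩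
  simp only [Multiset.toFinsupp_symm_apply, hab, map_add, Finsupp.toMultiset_single, one_smul]
  rfl

/-- Two sums of two unit vectors agree only if the indices agree up to order. -/
theorem eq_or_swap_of_single_add_single_eq {a b c d : σ}
    (h : Finsupp.single a 1 + Finsupp.single b 1 =
      (Finsupp.single c 1 + Finsupp.single d 1 : σ →₀ ℕ)) :
    (a = c ∧ b = d) ∨ (a = d ∧ b = c) := by
  simpa using (Finsupp.single_add_single_eq_single_add_single one_ne_zero one_ne_zero).mp h

/-- The exponent of the image `xᵢ yⱼ xₖ yₗ` of the monomial `zᵢⱼ zₖₗ`. -/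
noncomputable def segreExponent (p : (σ × τ) × (σ × τ)) : σ ⊕ τ →₀ ℕ :=
  (Finsupp.single p.1.1 1 + Finsupp.single p.2.1 1).mapDomain Sum.inl +
    (Finsupp.single p.1.2 1 + Finsupp.single p.2.2 1).mapDomain Sum.inr

theorem sumFinsuppEquivProdFinsupp_symm_eq (f : σ →₀ ℕ) (g : τ →₀ ℕ) :
    Finsupp.sumFinsuppEquivProdFinsupp.symm (f, g) =
      f.mapDomain Sum.inl + g.mapDomain Sum.inr := by
  ext (s | t)
  · rw [Finsupp.sumFinsuppEquivProdFinsupp_symm_inl, Finsupp.add_apply,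
      Finsupp.mapDomain_apply Sum.inl_injective, Finsupp.mapDomain_of_notMem_range _ _ (by simp),
      add_zero]
  · rw [Finsupp.sumFinsuppEquivProdFinsupp_symm_inr, Finsupp.add_apply,
      Finsupp.mapDomain_apply Sum.inr_injective, Finsupp.mapDomain_of_notMem_range _ _ (by simp),
      zero_add]

/-- Every exponent of bidegree `(2, 2)` is a Segre exponent. -/
theorem exists_segreExponent_eq {e : σ ⊕ τ →₀ ℕ}
    (hx : Finsupp.weight (Sum.elim (fun _ => (1 : ℕ)) fun _ => 0) e = 2)
    (hy : Finsupp.weight (Sum.elim (fun _ => (0 : ℕ)) fun _ => 1) e = 2) :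
    ∃ p : (σ × τ) × (σ × τ), segreExponent p = e := by
  obtain ⟨⟨f, g⟩, rfl⟩ := Finsupp.sumFinsuppEquivProdFinsupp.symm.surjective e
  rw [sumFinsuppEquivProdFinsupp_symm_eq] at hx hy ⊢
  have hf : Finsupp.weight (1 : σ → ℕ) f = 2 := by
    simpa [map_add, Finsupp.weight_apply, Finsupp.sum_mapDomain_index, add_mul] using hx
  have hg : Finsupp.weight (1 : τ → ℕ) g = 2 := by
    simpa [map_add, Finsupp.weight_apply, Finsupp.sum_mapDomain_index, add_mul] using hy
  obtain ⟨i, k, rfl⟩ := exists_eq_single_add_single_of_weight_one_eq_two hf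
  obtain ⟨j, l, rfl⟩ := exists_eq_single_add_single_of_weight_one_eq_two hg
  exact ⟨((i, j), (k, l)), rfl⟩

variable [CommRing K]

variable (σ τ K) in
/-- The Segre homomorphism `zᵢⱼ ↦ xᵢ yⱼ`. -/
noncomputable abbrev segre : MvPolynomial (σ × τ) K →ₐ[K] MvPolynomial (σ ⊕ τ) K :=
  aeval fun p : σ × τ => X (Sum.inl p.1) * X (Sum.inr p.2)

variable (σ τ K) in
/-- The span of the `2 × 2` minors of the generic matrix `(zᵢⱼ)`. -/
noncomputable abbrev spanMinors : Submodule K (MvPolynomial (σ × τ) K) :=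
  Submodule.span K {m | ∃ (i : σ) (j : τ) (k : σ) (l : τ),
    m = X (i, j) * X (k, l) - X (i, l) * X (k, j)}

theorem segre_X_mul_X (p : (σ × τ) × (σ × τ)) :
    segre σ τ K (X p.1 * X p.2) = monomial (segreExponent p) 1 := by
  rw [map_mul, aeval_X, aeval_X]
  simp only [segreExponent, X, monomial_mul, Finsupp.mapDomain_add,
    Finsupp.mapDomain_single, mul_one]
  exact congrArg (fun e => monomial e (1 : K)) (add_add_add_comm _ _ _ _)

theorem isHomogeneous_X_mul_X (a b : σ) : (X a * X b : MvPolynomial σ K).IsHomogeneous 2 :=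
  (isHomogeneous_X K a).mul (isHomogeneous_X K b)

/-- Quadratic monomials with the same image agree modulo the minors. -/
theorem X_mul_X_sub_mem_spanMinors {p q : (σ × τ) × (σ × τ)}
    (h : segreExponent p = segreExponent q) :
    X p.1 * X p.2 - X q.1 * X q.2 ∈ spanMinors σ τ K := by
  obtain ⟨⟨i, j⟩, ⟨k, l⟩⟩ := p
  obtain ⟨⟨i', j'⟩, ⟨k', l'⟩⟩ := q
  simp only [segreExponent, ← sumFinsuppEquivProdFinsupp_symm_eq, EmbeddingLike.apply_eq_iff_eq,
    Prod.mk.injEq] at h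
  obtain ⟨rfl, rfl⟩ | ⟨rfl, rfl⟩ := eq_or_swap_of_single_add_single_eq h.1 <;>
    obtain ⟨rfl, rfl⟩ | ⟨rfl, rfl⟩ := eq_or_swap_of_single_add_single_eq h.2
  · simp
  · exact Submodule.subset_span ⟨i, j, k, l, rfl⟩
  · exact Submodule.subset_span ⟨i, j, k, l, by simp only [mul_comm]⟩
  · simp [mul_comm]

open Classical in
variable (σ τ K) in
/-- A linear map sending each monomial of bidegree `(2, 2)` to a quadratic monomial above it. -/
noncomputable def segreLift : MvPolynomial (σ ⊕ τ) K →ₗ[K] MvPolynomial (σ × τ) K :=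
  (basisMonomials (σ ⊕ τ) K).constr K fun e =>
    if h : ∃ p, segreExponent p = e then X h.choose.1 * X h.choose.2 else 0

theorem exists_segreLift_monomial (p : (σ × τ) × (σ × τ)) :
    ∃ q, segreExponent q = segreExponent p ∧
      segreLift σ τ K (monomial (segreExponent p) 1) = X q.1 * X q.2 := by
  have h : ∃ q, segreExponent q = segreExponent p := ⟨p, rfl⟩
  refine ⟨h.choose, h.choose_spec, ?_⟩
  have := (basisMonomials (σ ⊕ τ) K).constr_basis K (fun e =>
    open Classical in
    if h : ∃ p : (σ × τ) × (σ × τ), segreExponent p = e then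
      (X h.choose.1 * X h.choose.2 : MvPolynomial (σ × τ) K) else 0) (segreExponent p)
  rw [coe_basisMonomials, dif_pos h] at this
  exact this

/-- Quadrics are recovered from their image modulo the minors. -/
theorem sub_segreLift_segre_mem_spanMinors {q : MvPolynomial (σ × τ) K}
    (hq : q.IsHomogeneous 2) : q - segreLift σ τ K (segre σ τ K q) ∈ spanMinors σ τ K := by
  suffices h : ∀ e ∈ q.support, monomial e (q.coeff e) -
      segreLift σ τ K (segre σ τ K (monomial e (q.coeff e))) ∈ spanMinors σ τ K by
    have hs := Submodule.sum_mem _ h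
    rwa [Finset.sum_sub_distrib, ← map_sum, ← map_sum, support_sum_monomial_coeff] at hs
  intro e he
  obtain ⟨a, b, hab⟩ :=
    exists_eq_single_add_single_of_weight_one_eq_two (hq (mem_support_iff.mp he))
  have hm : monomial e (q.coeff e) = q.coeff e • (X a * X b : MvPolynomial (σ × τ) K) := by
    simp [X, monomial_mul, smul_monomial, hab]
  obtain ⟨r, hr, hlift⟩ := exists_segreLift_monomial (K := K) (a, b)
  rw [hm, map_smul, map_smul, ← smul_sub, segre_X_mul_X (a, b), hlift]
  exact Submodule.smul_mem _ _ (X_mul_X_sub_mem_spanMinors (p := (a, b)) hr.symm)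

/-- A quadric vanishes under the Segre homomorphism iff it is a combination of minors. -/
theorem segre_eq_zero_iff_mem_spanMinors {q : MvPolynomial (σ × τ) K}
    (hq : q.IsHomogeneous 2) : segre σ τ K q = 0 ↔ q ∈ spanMinors σ τ K := by
  refine ⟨fun h => ?_, fun h => ?_⟩
  · have hs := sub_segreLift_segre_mem_spanMinors hq
    rwa [h, map_zero, sub_zero] at hs
  have hle : spanMinors σ τ K ≤ LinearMap.ker (segre σ τ K).toLinearMap := by
    rw [Submodule.span_le]
    rintro _ ⟨i, j, k, l, rfl⟩
    simp only [SetLike.mem_coe, LinearMap.mem_ker, AlgHom.toLinearMap_apply, map_sub, map_mul,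
      aeval_X]
    ring
  exact hle h

/-- Every form of bidegree `(2, 2)` is the image of a quadric. -/
theorem exists_isHomogeneous_segre_eq {p : MvPolynomial (σ ⊕ τ) K}
    (hx : IsWeightedHomogeneous (Sum.elim (fun _ => (1 : ℕ)) fun _ => 0) p 2)
    (hy : IsWeightedHomogeneous (Sum.elim (fun _ => (0 : ℕ)) fun _ => 1) p 2) :
    ∃ q : MvPolynomial (σ × τ) K, q.IsHomogeneous 2 ∧ segre σ τ K q = p := by
  suffices h : p ∈ (homogeneousSubmodule (σ × τ) K 2).map (segre σ τ K).toLinearMap from h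
  rw [← support_sum_monomial_coeff p]
  refine Submodule.sum_mem _ fun e he => ?_
  have hc := mem_support_iff.mp he
  obtain ⟨r, rfl⟩ := exists_segreExponent_eq (hx hc) (hy hc)
  refine ⟨p.coeff (segreExponent r) • (X r.1 * X r.2),
    Submodule.smul_mem _ _ (isHomogeneous_X_mul_X r.1 r.2), ?_⟩
  rw [map_smul, AlgHom.toLinearMap_apply, segre_X_mul_X, smul_monomial, smul_eq_mul, mul_one]

end Segre

/-- Let `K` be a field and `φ : K[z₁₁,…,z₃₃] → K[x₁,x₂,x₃,y₁,y₂,y₃]` be the `K`-algebra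
homomorphism `zᵢⱼ ↦ xᵢ yⱼ`. Then (a) a homogeneous quadric `q` satisfies `φ q = 0` iff `q`
lies in the `K`-span of the 2×2 minors `zᵢⱼ z_{kl} - z_{il} z_{kj}`; and (b) every
polynomial bihomogeneous of bidegree (2,2) in the `xᵢ` and `yⱼ` is of the form `φ q` for
some homogeneous quadric `q`. -/
theorem stmt_3 {K : Type*} [Field K]
    (φ : MvPolynomial (Fin 3 × Fin 3) K →ₐ[K] MvPolynomial (Fin 3 ⊕ Fin 3) K)
    (hφ : φ = aeval fun p : Fin 3 × Fin 3 => X (Sum.inl p.1) * X (Sum.inr p.2)) :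
    (∀ q : MvPolynomial (Fin 3 × Fin 3) K, q.IsHomogeneous 2 →
      (φ q = 0 ↔ q ∈ Submodule.span K
        {m : MvPolynomial (Fin 3 × Fin 3) K | ∃ i j k l : Fin 3,
          m = X (i, j) * X (k, l) - X (i, l) * X (k, j)})) ∧
    (∀ p : MvPolynomial (Fin 3 ⊕ Fin 3) K,
      IsWeightedHomogeneous (Sum.elim (fun _ => (1 : ℕ)) fun _ => 0) p 2 →
      IsWeightedHomogeneous (Sum.elim (fun _ => (0 : ℕ)) fun _ => 1) p 2 →
      ∃ q : MvPolynomial (Fin 3 × Fin 3) K, q.IsHomogeneous 2 ∧ φ q = p) := by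
  subst hφ
  exact ⟨fun q hq => segre_eq_zero_iff_mem_spanMinors hq,
    fun p hx hy => exists_isHomogeneous_segre_eq hx hy⟩
end

section
/- For every natural number n ≥ 1 and every real n×n matrix M, one has nⁿ · (det M)² ≤ (∑ᵢⱼ Mᵢⱼ²)ⁿ; equivalently, |det M|^{2/n} ≤ (1/n)·‖M‖_F². -/
/-- The inequality of arithmetic and geometric means, in polynomial form. -/
lemma card_pow_mul_prod_le_sum_pow {ι : Type*} [Fintype ι] (z : ι → ℝ) (hz : ∀ i, 0 ≤ z i) :
    (Fintype.card ι : ℝ) ^ Fintype.card ι * ∏ i, z i ≤ (∑ i, z i) ^ Fintype.card ι := by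
  rcases isEmpty_or_nonempty ι with _ | _
  · simp
  have hcard : (0 : ℝ) < Fintype.card ι := by exact_mod_cast Fintype.card_pos
  have hprod : 0 ≤ ∏ i, z i := Finset.prod_nonneg fun i _ => hz i
  have amgm := Real.geom_mean_le_arith_mean Finset.univ (fun _ : ι => (1 : ℝ)) z
    (fun _ _ => zero_le_one) (by simpa using hcard) fun i _ => hz i
  simp only [Real.rpow_one, one_mul, Finset.sum_const, Finset.card_univ, nsmul_eq_mul,
    mul_one] at amgm
  have hpow := pow_le_pow_left₀ (Real.rpow_nonneg hprod _) amgm (Fintype.card ι)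
  rwa [Real.rpow_inv_natCast_pow hprod Fintype.card_ne_zero, div_pow,
    le_div_iff₀ (pow_pos hcard _), mul_comm] at hpow

/-- A positive semidefinite real matrix satisfies `nⁿ · det A ≤ (tr A)ⁿ`. -/
lemma Matrix.PosSemidef.card_pow_mul_det_le_trace_pow {ι : Type*} [Fintype ι] [DecidableEq ι]
    {A : Matrix ι ι ℝ} (hA : A.PosSemidef) :
    (Fintype.card ι : ℝ) ^ Fintype.card ι * A.det ≤ A.trace ^ Fintype.card ι := by
  rw [hA.isHermitian.det_eq_prod_eigenvalues, hA.isHermitian.trace_eq_sum_eigenvalues]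
  exact card_pow_mul_prod_le_sum_pow _ hA.eigenvalues_nonneg

/-- For every `n ≥ 1` and every real `n × n` matrix `M`,
`nⁿ · (det M)² ≤ (∑ᵢⱼ Mᵢⱼ²)ⁿ`. -/
theorem stmt_4 (n : ℕ) (hn : 1 ≤ n) (M : Matrix (Fin n) (Fin n) ℝ) :
    (n : ℝ) ^ n * M.det ^ 2 ≤ (∑ i, ∑ j, M i j ^ 2) ^ n := by
  have h := (Matrix.posSemidef_self_mul_conjTranspose M).card_pow_mul_det_le_trace_pow
  have htrace : (M * M.conjTranspose).trace = ∑ i, ∑ j, M i j ^ 2 := by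
    simp [Matrix.trace, Matrix.mul_apply, sq]
  have hdet : (M * M.conjTranspose).det = M.det ^ 2 := by
    simp [Matrix.det_mul, sq]
  rwa [htrace, hdet, Fintype.card_fin] at h
end

section
/- Let n ≥ 1 and let M be a real n×n matrix whose determinant is an integer (det M = k for some k ∈ ℤ). If ∑ᵢⱼ Mᵢⱼ² < n, then det M = 0. -/
/-- The determinant of a real positive semidefinite matrix `A` of size `m` is at most
`exp (tr A - m)`. -/
theorem Matrix.PosSemidef.det_le_exp_trace_sub_card {m : Type*} [Fintype m] [DecidableEq m]
    {A : Matrix m m ℝ} (hA : A.PosSemidef) :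
    A.det ≤ Real.exp (A.trace - Fintype.card m) := by
  have hdet : A.det = ∏ i, hA.1.eigenvalues i := by
    simpa using hA.1.det_eq_prod_eigenvalues
  have htrace : A.trace = ∑ i, hA.1.eigenvalues i := by
    simpa using hA.1.trace_eq_sum_eigenvalues
  calc A.det = ∏ i, hA.1.eigenvalues i := hdet
    _ ≤ ∏ i, Real.exp (hA.1.eigenvalues i - 1) :=
      Finset.prod_le_prod (fun i _ => hA.eigenvalues_nonneg i) fun i _ => by
        linarith [Real.add_one_le_exp (hA.1.eigenvalues i - 1)]
    _ = Real.exp (A.trace - Fintype.card m) := by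
      rw [← Real.exp_sum, htrace]
      simp

/-- A real square matrix of size `m` whose squared Frobenius norm is less than `m` has determinant
of absolute value less than one. -/
theorem Matrix.abs_det_lt_one_of_sum_sq_lt_card {m : Type*} [Fintype m] [DecidableEq m]
    (M : Matrix m m ℝ) (hM : ∑ i, ∑ j, M i j ^ 2 < (Fintype.card m : ℝ)) :
    |M.det| < 1 := by
  have htrace : (M.conjTranspose * M).trace = ∑ i, ∑ j, M i j ^ 2 := by
    rw [Finset.sum_comm]
    simp [Matrix.trace, Matrix.mul_apply, sq]
  have hle := (Matrix.posSemidef_conjTranspose_mul_self M).det_le_exp_trace_sub_card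
  have hlt : Real.exp ((M.conjTranspose * M).trace - Fintype.card m) < 1 :=
    Real.exp_lt_one_iff.mpr (by linarith)
  have hdet : (M.conjTranspose * M).det = M.det ^ 2 := by
    simp [Matrix.det_mul, sq]
  rw [← sq_lt_one_iff_abs_lt_one]
  linarith

/-- Let `n ≥ 1` and let `M` be a real `n × n` matrix whose determinant is an integer.
If `∑ᵢⱼ Mᵢⱼ² < n`, then `det M = 0`. -/
theorem stmt_5 (n : ℕ) (hn : 1 ≤ n) (M : Matrix (Fin n) (Fin n) ℝ)
    (hint : ∃ k : ℤ, M.det = (k : ℝ)) (hF : ∑ i, ∑ j, M i j ^ 2 < (n : ℝ)) :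
    M.det = 0 := by
  obtain ⟨k, hk⟩ := hint
  have hlt := M.abs_det_lt_one_of_sum_sq_lt_card (by simpa using hF)
  rw [hk] at hlt ⊢
  exact_mod_cast Int.abs_lt_one_iff.mp (by exact_mod_cast hlt)
end

section
/- Let L be a ℤ-lattice in the 9-dimensional Euclidean space ℝ⁹ (a discrete additive subgroup spanning ℝ⁹ over ℝ) whose covolume (the volume of a fundamental domain with respect to Lebesgue measure) equals 1. Then there exists a nonzero vector x ∈ L with ‖x‖² < 3. -/
open MeasureTheory

/-- Blichfeldt's principle with multiplicity: if the measure of `s` exceeds `k` times that of a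
fundamental domain, then some orbit meets `s` for at least `k + 1` group elements. -/
theorem exists_finset_card_forall_vadd_mem {G E : Type*} [AddGroup G] [Countable G]
    [AddAction G E] [MeasurableSpace E] [MeasurableConstVAdd G E] {μ : Measure E}
    [VAddInvariantMeasure G E μ] {F s : Set E} (fund : IsAddFundamentalDomain G F μ)
    (hs : MeasurableSet s) (k : ℕ) (h : k * μ F < μ s) :
    ∃ (x : E) (t : Finset G), t.card = k + 1 ∧ ∀ g ∈ t, g +ᵥ x ∈ s := by
  classical
  contrapose! h
  have key (x : E) : ∑' g : G, s.indicator (1 : E → ENNReal) (g +ᵥ x) ≤ k := by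
    rw [ENNReal.tsum_eq_iSup_sum]
    refine iSup_le fun T => ?_
    have hsum : ∑ g ∈ T, s.indicator (1 : E → ENNReal) (g +ᵥ x) =
        (T.filter fun g => g +ᵥ x ∈ s).card := by
      simp [Set.indicator_apply]
    rw [hsum, Nat.cast_le]
    by_contra! hlt
    obtain ⟨t, ht, hcard⟩ := Finset.exists_subset_card_eq (Nat.succ_le_of_lt hlt)
    obtain ⟨g, hg, hgs⟩ := h x t hcard
    exact hgs (Finset.mem_filter.mp (ht hg)).2
  calc μ s = ∫⁻ x, s.indicator 1 x ∂μ := (lintegral_indicator_one hs).symm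
    _ = ∑' g : G, ∫⁻ x in F, s.indicator 1 (g +ᵥ x) ∂μ := fund.lintegral_eq_tsum'' _
    _ = ∫⁻ x in F, ∑' g : G, s.indicator 1 (g +ᵥ x) ∂μ :=
      (lintegral_tsum fun g =>
        ((measurable_one.indicator hs).comp (measurable_const_vadd g)).aemeasurable).symm
    _ ≤ ∫⁻ _ in F, k ∂μ := lintegral_mono key
    _ = k * μ F := setLIntegral_const _ _

theorem norm_sub_sq_add_norm_sub_sq_add_norm_sub_sq_le {E : Type*} [NormedAddCommGroup E]
    [InnerProductSpace ℝ E] (a b c : E) :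
    ‖a - b‖ ^ 2 + ‖a - c‖ ^ 2 + ‖b - c‖ ^ 2 ≤ 3 * (‖a‖ ^ 2 + ‖b‖ ^ 2 + ‖c‖ ^ 2) := by
  have h := sq_nonneg ‖a + b + c‖
  rw [norm_add_sq_real, norm_add_sq_real, inner_add_left] at h
  simp only [norm_sub_sq_real]
  linarith

theorem two_lt_volume_ball_fin_nine :
    2 < volume (Metric.ball (0 : EuclideanSpace ℝ (Fin 9)) 1) := by
  have hG : Real.Gamma ((9 : ℝ) / 2 + 1) = 945 / 32 * √Real.pi := by
    have h := Real.Gamma_nat_add_half 5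
    norm_num [Nat.doubleFactorial] at h
    norm_num
    rw [h]
    ring
  rw [EuclideanSpace.volume_ball]
  simp only [Fintype.card_fin, ENNReal.ofReal_one, one_pow, one_mul, Nat.cast_ofNat]
  rw [hG, show (2 : ENNReal) = ENNReal.ofReal 2 by simp, ENNReal.ofReal_lt_ofReal_iff']
  have hpos : 0 < √Real.pi := Real.sqrt_pos.mpr Real.pi_pos
  have hpow : √Real.pi ^ 9 = Real.pi ^ 4 * √Real.pi := by
    rw [pow_succ, show 8 = 2 * 4 from rfl, pow_mul, Real.sq_sqrt Real.pi_pos.le]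
  have hpi : (3 : ℝ) ^ 4 < Real.pi ^ 4 := by
    gcongr
    exact Real.pi_gt_three
  have h2 : 2 < √Real.pi ^ 9 / (945 / 32 * √Real.pi) := by
    rw [hpow, lt_div_iff₀ (by positivity)]
    nlinarith
  exact ⟨h2, by linarith⟩

/-- Every `ℤ`-lattice of covolume 1 in 9-dimensional Euclidean space contains a nonzero
vector `x` with `‖x‖² = ∑ᵢ xᵢ² < 3`. -/
theorem stmt_7 (L : Submodule ℤ (EuclideanSpace ℝ (Fin 9)))
    [DiscreteTopology L] [IsZLattice ℝ L]
    (hcov : ZLattice.covolume L volume = 1) :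
    ∃ x ∈ L, x ≠ 0 ∧ ∑ i, x i ^ 2 < 3 := by
  have fund := ZLattice.isAddFundamentalDomain (Module.Free.chooseBasis ℤ L)
    (volume : Measure (EuclideanSpace ℝ (Fin 9)))
  have hF := ZLattice.covolume_eq_measure_fundamentalDomain L volume fund
  rw [hcov, measureReal_def, eq_comm, ENNReal.toReal_eq_one_iff] at hF
  have : MeasurableConstVAdd L (EuclideanSpace ℝ (Fin 9)) :=
    inferInstanceAs (MeasurableConstVAdd L.toAddSubgroup _)
  have : VAddInvariantMeasure L (EuclideanSpace ℝ (Fin 9)) volume :=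
    inferInstanceAs (VAddInvariantMeasure L.toAddSubgroup _ _)
  obtain ⟨x, t, ht, hx⟩ := exists_finset_card_forall_vadd_mem fund
    (Metric.isOpen_ball (x := 0) (ε := 1)).measurableSet 2
    (by simpa [hF] using two_lt_volume_ball_fin_nine)
  obtain ⟨a, b, c, hab, hac, hbc, rfl⟩ := Finset.card_eq_three.mp ht
  have hsq (g : L) (hg : g +ᵥ x ∈ Metric.ball (0 : EuclideanSpace ℝ (Fin 9)) 1) :
      ‖(g : EuclideanSpace ℝ (Fin 9)) + x‖ ^ 2 < 1 := by
    have hg' : ‖(g : EuclideanSpace ℝ (Fin 9)) + x‖ < 1 := mem_ball_zero_iff.mp hg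
    exact pow_lt_one₀ (norm_nonneg _) hg' two_ne_zero
  have ha := hsq a (hx a (by simp))
  have hb := hsq b (hx b (by simp))
  have hc := hsq c (hx c (by simp))
  have hsum := norm_sub_sq_add_norm_sub_sq_add_norm_sub_sq_le (a + x : EuclideanSpace ℝ (Fin 9))
    (b + x) (c + x)
  simp only [add_sub_add_right_eq_sub] at hsum
  by_contra! hL
  have hdist (g g' : L) (hne : g ≠ g') : 3 ≤ ‖(g - g' : EuclideanSpace ℝ (Fin 9))‖ ^ 2 := by
    rw [EuclideanSpace.real_norm_sq_eq]
    exact hL _ (L.sub_mem g.2 g'.2) (sub_ne_zero.mpr (Subtype.coe_ne_coe.mpr hne))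
  linarith [hdist a b hab, hdist a c hac, hdist b c hbc]
end

section
/- Let K be a field, n ≥ 1, and A a finite-dimensional central simple K-algebra with dim_K A = n². Suppose there exist x ∈ A and a natural number r with r coprime to n such that the left ideal A·x = {a·x : a ∈ A} has dimension r·n as a K-vector space. Then A is isomorphic as a K-algebra to Mat_n(K). -/
open Module in
/-- A finite-dimensional simple algebra is a matrix algebra over the opposite of the endomorphism
algebra of a simple left ideal `S`, and the dimension of every left ideal is a multiple of
the dimension of `S`. -/
theorem IsSimpleRing.exists_simple_ideal_algEquiv_matrix (K : Type*) [Field K]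
    (A : Type*) [Ring A] [Algebra K A] [FiniteDimensional K A] [IsSimpleRing A] :
    ∃ (k : ℕ) (S : Ideal A), finrank K A = k * finrank K S ∧
      Nonempty (A ≃ₐ[K] Matrix (Fin k) (Fin k) (Module.End A S)ᵐᵒᵖ) ∧
      ∀ I : Ideal A, finrank K S ∣ finrank K I := by
  have : IsArtinianRing A := IsArtinianRing.of_finite K A
  obtain ⟨k, hk, S, hS, ⟨e⟩⟩ := (IsSimpleRing.isIsotypic A A).linearEquiv_fun
  refine ⟨k, S, ?_, ⟨.trans (.opOp K A) <| .trans (.op ?_) (.symm .mopMatrix)⟩, fun I ↦ ?_⟩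
  · simpa using (e.restrictScalars K).finrank_eq.trans (finrank_pi_fintype K)
  · exact .trans (.moduleEndSelf K) <| .trans (e.conjAlgEquiv K) (endVecAlgEquivMatrixEnd ..)
  · obtain ⟨c, ⟨f⟩⟩ := ((IsSimpleRing.isIsotypic A A S).of_injective I.subtype
      I.injective_subtype).linearEquiv_fun
    refine ⟨c, ?_⟩
    rw [mul_comm]
    simpa using (f.restrictScalars K).finrank_eq.trans (finrank_pi_fintype K)

/-- The matrix algebra over a one-dimensional algebra is the matrix algebra over the field. -/
theorem Matrix.nonempty_algEquiv_of_finrank_eq_one {K D : Type*} [Field K] [Ring D] [Algebra K D]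
    (h : Module.finrank K D = 1) (k : ℕ) :
    Nonempty (Matrix (Fin k) (Fin k) D ≃ₐ[K] Matrix (Fin k) (Fin k) K) := by
  have : Nontrivial D := Module.nontrivial_of_finrank_pos (R := K) (by omega)
  have hbij : Function.Bijective (Algebra.ofId K D) :=
    ⟨(algebraMap K D).injective,
      Algebra.surjective_algebraMap_iff.mpr (Subalgebra.bot_eq_top_of_finrank_eq_one h).symm⟩
  exact ⟨(AlgEquiv.ofBijective _ hbij).symm.mapMatrix⟩

/-- If `k² d = n²`, and `r` is coprime to `n` with `k d ∣ r n`, then `d = 1` and `k = n`. -/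
theorem Nat.eq_one_and_eq_of_sq_mul_eq_sq {n k d r : ℕ} (hn : 1 ≤ n) (h : n ^ 2 = k ^ 2 * d)
    (hr : Nat.Coprime r n) (hdvd : k * d ∣ r * n) : d = 1 ∧ k = n := by
  obtain ⟨m, rfl⟩ : k ∣ n := (Nat.pow_dvd_pow_iff two_ne_zero).mp ⟨d, h⟩
  have hk : 0 < k := Nat.pos_of_ne_zero (by rintro rfl; simp at hn)
  have hm : 0 < m := Nat.pos_of_ne_zero (by rintro rfl; simp at hn)
  obtain rfl : m ^ 2 = d := Nat.eq_of_mul_eq_mul_left (pow_pos hk 2) (by rw [← h, mul_pow])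
  have hmr : m ∣ r := by
    apply Nat.dvd_of_mul_dvd_mul_right (Nat.mul_pos hk hm)
    convert hdvd using 1
    ring
  obtain rfl : m = 1 := Nat.eq_one_of_dvd_coprimes hr hmr (Dvd.intro_left k rfl)
  simp


/-- Let `K` be a field, `n ≥ 1`, and `A` a central simple `K`-algebra of dimension `n²`.
If there is an `x ∈ A` and `r` coprime to `n` such that the left ideal `A·x` has
`K`-dimension `r·n`, then `A ≅ Mat_n(K)` as `K`-algebras. -/
theorem stmt_9 {K : Type*} [Field K] (n : ℕ) (hn : 1 ≤ n)
    (A : Type*) [Ring A] [Algebra K A] [FiniteDimensional K A]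
    (hcentral : Subalgebra.center K A = ⊥)
    (hsimple : ∀ I : TwoSidedIdeal A, I = ⊥ ∨ I = ⊤)
    (hdim : Module.finrank K A = n ^ 2)
    (x : A) (r : ℕ) (hr : Nat.Coprime r n)
    (hrank : Module.finrank K (LinearMap.range (LinearMap.mulRight K x)) = r * n) :
    Nonempty (A ≃ₐ[K] Matrix (Fin n) (Fin n) K) := by
  have : Nontrivial A := Module.nontrivial_of_finrank_pos (R := K) (by rw [hdim]; positivity)
  have : IsSimpleRing A := ⟨⟨hsimple⟩⟩
  obtain ⟨k, S, hA, ⟨e⟩, hI⟩ := IsSimpleRing.exists_simple_ideal_algEquiv_matrix K A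
  have hx : LinearMap.range (LinearMap.mulRight K x) = (Ideal.span {x}).restrictScalars K := by
    ext y
    simp [Ideal.mem_span_singleton']
  have hdvd : Module.finrank K S ∣ r * n := by
    rw [← hrank, hx]
    exact hI (Ideal.span {x})
  set d := Module.finrank K (Module.End A S)ᵐᵒᵖ
  have hn2 : n ^ 2 = k ^ 2 * d := by
    rw [← hdim, e.toLinearEquiv.finrank_eq, Module.finrank_matrix, Fintype.card_fin, sq]
  have hk : 0 < k := Nat.pos_of_ne_zero (by rintro rfl; simp at hn2; omega)
  have hS : Module.finrank K S = k * d := by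
    apply Nat.eq_of_mul_eq_mul_left hk
    rw [← hA, hdim, hn2]
    ring
  obtain ⟨hd1, rfl⟩ := Nat.eq_one_and_eq_of_sq_mul_eq_sq hn hn2 hr (hS ▸ hdvd)
  exact (Matrix.nonempty_algEquiv_of_finrank_eq_one hd1 k).map e.trans
end

section
/- Let 𝒪 be a subring (containing the identity matrix) of the algebra Mat₃(ℝ) of real 3×3 matrices such that there exist M₁, …, M₉ ∈ 𝒪 forming an ℝ-basis of Mat₃(ℝ), with 𝒪 equal (as an additive group) to the ℤ-span of M₁, …, M₉, and such that the 9×9 real matrix B whose i-th row lists the nine entries of Mᵢ satisfies |det B| = 1. Then 𝒪 contains a nonzero matrix M with det M = 0. -/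
open MeasureTheory Module

open Real in
theorem integral_exp_neg_norm_div_three :
    ∫ r : Fin 3 → ℝ, exp (-(‖WithLp.toLp 2 r‖ / 3)) = 216 * π := by
  have h := (EuclideanSpace.volume_preserving_symm_measurableEquiv_toLp (Fin 3)).symm.integral_comp'
    (fun x : EuclideanSpace ℝ (Fin 3) => exp (-(‖x‖ / 3)))
  have h2 := integral_rpow_mul_exp_neg_mul_Ioi (a := 3) (r := 1 / 3) (by norm_num) (by norm_num)
  have h3 := integral_fun_norm_addHaar (volume : Measure (EuclideanSpace ℝ (Fin 3)))
    (fun y => exp (-(y / 3)))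
  have hG : Gamma 3 = 2 := by
    simp
  have h4 : ∫ y in Set.Ioi (0 : ℝ), y ^ 2 * exp (-(y / 3)) = 54 := by
    rw [hG] at h2
    norm_num at h2
    rw [← h2]
    congr 1 with y
    congr 3
    ring
  have h5 : (volume : Measure (EuclideanSpace ℝ (Fin 3))).real (Metric.ball 0 1) = π * 4 / 3 := by
    rw [measureReal_def, EuclideanSpace.volume_ball_fin_three]
    simp
    positivity
  simp only [finrank_euclideanSpace, Fintype.card_fin, smul_eq_mul, h5, nsmul_eq_mul] at h3
  norm_num at h3
  rw [h4] at h3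
  exact (h.trans h3).trans (by ring)

/-- Hadamard's inequality for real `3 × 3` matrices. -/
theorem abs_det_le_prod_norm_row (N : Fin 3 → Fin 3 → ℝ) :
    |(Matrix.of N).det| ≤ ∏ i, ‖WithLp.toLp 2 (N i)‖ := by
  refine abs_le_of_sq_le_sq ?_ (by positivity)
  rw [← Finset.prod_pow]
  simp only [EuclideanSpace.norm_sq_eq, Fin.prod_univ_three, Fin.sum_univ_three,
    Matrix.det_fin_three, Matrix.of_apply, Real.norm_eq_abs, sq_abs]
  generalize N 0 0 = a0, N 0 1 = a1, N 0 2 = a2, N 1 0 = b0, N 1 1 = b1, N 1 2 = b2,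
    N 2 0 = c0, N 2 1 = c1, N 2 2 = c2
  calc _ = (a0 * (b1 * c2 - b2 * c1) + a1 * (b2 * c0 - b0 * c2) + a2 * (b0 * c1 - b1 * c0)) ^ 2 := by
        ring
    _ ≤ (a0 ^ 2 + a1 ^ 2 + a2 ^ 2) * ((b1 * c2 - b2 * c1) ^ 2 + (b2 * c0 - b0 * c2) ^ 2
        + (b0 * c1 - b1 * c0) ^ 2) := by
      generalize b1 * c2 - b2 * c1 = x, b2 * c0 - b0 * c2 = y, b0 * c1 - b1 * c0 = z
      nlinarith [sq_nonneg (a0 * y - a1 * x), sq_nonneg (a0 * z - a2 * x),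
        sq_nonneg (a1 * z - a2 * y)]
    _ ≤ (a0 ^ 2 + a1 ^ 2 + a2 ^ 2) * ((b0 ^ 2 + b1 ^ 2 + b2 ^ 2) * (c0 ^ 2 + c1 ^ 2 + c2 ^ 2)) := by
      gcongr
      nlinarith [sq_nonneg (b0 * c0 + b1 * c1 + b2 * c2)]
    _ = _ := by ring

theorem abs_det_lt_one_of_sum_norm_row_lt (N : Fin 3 → Fin 3 → ℝ)
    (h : ∑ i, ‖WithLp.toLp 2 (N i)‖ / 3 < 1) :
    |(Matrix.of N).det| < 1 := by
  refine (abs_det_le_prod_norm_row N).trans_lt ?_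
  rw [Fin.sum_univ_three] at h
  rw [Fin.prod_univ_three]
  have h0 := norm_nonneg (WithLp.toLp 2 (N 0))
  have h1 := norm_nonneg (WithLp.toLp 2 (N 1))
  have h2 := norm_nonneg (WithLp.toLp 2 (N 2))
  generalize ‖WithLp.toLp 2 (N 0)‖ = x, ‖WithLp.toLp 2 (N 1)‖ = y, ‖WithLp.toLp 2 (N 2)‖ = z at *
  have : x * y * z ≤ ((x + y + z) / 3) ^ 3 := by
    nlinarith [mul_nonneg h0 (sq_nonneg (y - z)), mul_nonneg h1 (sq_nonneg (x - z)),
      mul_nonneg h2 (sq_nonneg (x - y)), mul_nonneg h0 (sq_nonneg (x - z)),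
      mul_nonneg h0 (sq_nonneg (x - y)), mul_nonneg h1 (sq_nonneg (y - z)),
      mul_nonneg h1 (sq_nonneg (y - x)), mul_nonneg h2 (sq_nonneg (z - y)),
      mul_nonneg h2 (sq_nonneg (z - x))]
  exact this.trans_lt (pow_lt_one₀ (by positivity) (by linarith) (by norm_num))

/-- The mean of the Euclidean norms of the rows of a real `3 × 3` matrix. -/
noncomputable def meanRowNorm : Seminorm ℝ (Fin 3 → Fin 3 → ℝ) :=
  Seminorm.of (fun N => ∑ i, ‖WithLp.toLp 2 (N i)‖ / 3)
    (fun x y => by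
      rw [← Finset.sum_add_distrib]
      gcongr with i
      rw [← add_div]
      gcongr
      exact norm_add_le (WithLp.toLp 2 (x i)) (WithLp.toLp 2 (y i)))
    (fun a x => by simp [WithLp.toLp_smul, norm_smul, Finset.mul_sum, mul_div_assoc])

theorem meanRowNorm_apply (N : Fin 3 → Fin 3 → ℝ) :
    meanRowNorm N = ∑ i, ‖WithLp.toLp 2 (N i)‖ / 3 := rfl

theorem eq_zero_of_meanRowNorm_eq_zero {N : Fin 3 → Fin 3 → ℝ} (h : meanRowNorm N = 0) :
    N = 0 := by
  rw [meanRowNorm_apply, Finset.sum_eq_zero_iff_of_nonneg fun _ _ => by positivity] at h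
  ext1 i
  simpa using h i (Finset.mem_univ i)

open Real in
theorem volume_meanRowNorm_lt_one :
    volume {N | meanRowNorm N < 1} = ENNReal.ofReal ((216 * π) ^ 3 / Nat.factorial 9) := by
  rw [measure_lt_one_eq_integral_div_gamma volume (map_zero meanRowNorm)
    (map_neg_eq_map meanRowNorm) (map_add_le_add meanRowNorm) eq_zero_of_meanRowNorm_eq_zero
    (fun r x => (map_smul_eq_mul meanRowNorm r x).le) one_pos]
  have hfin : finrank ℝ (Fin 3 → Fin 3 → ℝ) = 9 := by simp [finrank_pi_fintype]
  have hint := integral_fintype_prod_volume_eq_pow (ι := Fin 3)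
    fun r : Fin 3 → ℝ => exp (-(‖WithLp.toLp 2 r‖ / 3))
  rw [integral_exp_neg_norm_div_three, Fintype.card_fin] at hint
  rw [hfin, ← hint, ← Gamma_nat_eq_factorial]
  simp [meanRowNorm_apply, ← Real.exp_sum]

theorem two_pow_nine_lt_volume_meanRowNorm_lt_one :
    2 ^ 9 < volume {N | meanRowNorm N < 1} := by
  rw [volume_meanRowNorm_lt_one, ENNReal.lt_ofReal_iff_toReal_lt (by finiteness)]
  have h : (648 : ℝ) ^ 3 ≤ (216 * Real.pi) ^ 3 := by
    gcongr
    linarith [Real.pi_gt_three]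
  rw [lt_div_iff₀ (by positivity)]
  norm_num [Nat.factorial] at h ⊢
  linarith

/-- The matrix units, as a basis indexed by `Fin 9` through `finProdFinEquiv`. -/
noncomputable def matrixUnitsBasis : Basis (Fin 9) ℝ (Fin 3 → Fin 3 → ℝ) :=
  (Pi.basis fun _ : Fin 3 => Pi.basisFun ℝ (Fin 3)).reindex
    ((Equiv.sigmaEquivProd (Fin 3) (Fin 3)).trans finProdFinEquiv)

theorem matrixUnitsBasis_repr (N : Fin 3 → Fin 3 → ℝ) (p : Fin 3 × Fin 3) :
    matrixUnitsBasis.repr N (finProdFinEquiv p) = N p.1 p.2 := by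
  rw [matrixUnitsBasis, Basis.repr_reindex_apply]
  simp [Pi.basis_repr]

theorem volume_fundamentalDomain_matrixUnitsBasis :
    volume (ZSpan.fundamentalDomain matrixUnitsBasis) = 1 := by
  have h : ZSpan.fundamentalDomain matrixUnitsBasis =
      Set.univ.pi fun _ : Fin 3 => Set.univ.pi fun _ : Fin 3 => Set.Ico (0 : ℝ) 1 := by
    ext N
    rw [ZSpan.mem_fundamentalDomain, ← (finProdFinEquiv (m := 3) (n := 3)).forall_congr_right]
    simp only [matrixUnitsBasis_repr, Prod.forall, Set.mem_pi, Set.mem_univ, true_imp_iff]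
  simp [h, volume_pi_pi]

open scoped Kronecker in
/-- If left multiplication by `N` preserves a full lattice in the real `3 × 3` matrices, then its
determinant `N.det ^ 3` is an integer. -/
theorem exists_int_det_pow_three (M : Fin 9 → Matrix (Fin 3) (Fin 3) ℝ)
    (B : Matrix (Fin 9) (Fin 9) ℝ)
    (hB : ∀ (s : Fin 9) (p : Fin 3 × Fin 3), B s (finProdFinEquiv p) = M s p.1 p.2)
    (hdet : B.det ≠ 0) (N : Matrix (Fin 3) (Fin 3) ℝ)
    (hN : ∀ s, N * M s ∈ Submodule.span ℤ (Set.range M)) :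
    ∃ n : ℤ, N.det ^ 3 = n := by
  simp only [Submodule.mem_span_range_iff_exists_fun] at hN
  choose A hA using hN
  let K : Matrix (Fin 9) (Fin 9) ℝ :=
    Matrix.reindex finProdFinEquiv finProdFinEquiv (N ⊗ₖ (1 : Matrix (Fin 3) (Fin 3) ℝ))
  have hK : K.det = N.det ^ 3 := by
    rw [Matrix.det_reindex_self, Matrix.det_kronecker]
    simp
  have hmul : B * K.transpose = (Matrix.of A).map (Int.castRingHom ℝ) * B := by
    ext s q
    obtain ⟨⟨i, k⟩, rfl⟩ := (finProdFinEquiv (m := 3) (n := 3)).surjective q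
    have h := congr_fun₂ (hA s) i k
    rw [Matrix.mul_apply, Matrix.mul_apply, ← (finProdFinEquiv (m := 3) (n := 3)).sum_comp]
    simp only [hB, Matrix.map_apply, Matrix.of_apply, K, Matrix.transpose_apply,
      Matrix.reindex_apply, Matrix.submatrix_apply, Equiv.symm_apply_apply,
      Matrix.kroneckerMap_apply, Fintype.sum_prod_type, Matrix.one_apply]
    rw [Matrix.sum_apply, Matrix.mul_apply] at h
    simpa [mul_comm] using h.symm
  refine ⟨(Matrix.of A).det, mul_left_cancel₀ hdet ?_⟩
  have h := congr_arg Matrix.det hmul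
  rw [Matrix.det_mul, Matrix.det_mul, Matrix.det_transpose, hK, ← RingHom.mapMatrix_apply,
    ← RingHom.map_det] at h
  rw [h, mul_comm]
  rfl

/-- Minkowski's theorem for the body `meanRowNorm < 1`. -/
theorem exists_mem_span_meanRowNorm_lt_one (b : Basis (Fin 9) ℝ (Fin 3 → Fin 3 → ℝ))
    (B : Matrix (Fin 9) (Fin 9) ℝ)
    (hB : ∀ (s : Fin 9) (p : Fin 3 × Fin 3), B s (finProdFinEquiv p) = b s p.1 p.2)
    (hdet : |B.det| = 1) :
    ∃ N ∈ Submodule.span ℤ (Set.range b), N ≠ 0 ∧ meanRowNorm N < 1 := by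
  have hBT : matrixUnitsBasis.toMatrix b = B.transpose := by
    ext q s
    obtain ⟨p, rfl⟩ := (finProdFinEquiv (m := 3) (n := 3)).surjective q
    rw [Basis.toMatrix_apply, matrixUnitsBasis_repr, Matrix.transpose_apply, hB]
  have hvol : volume (ZSpan.fundamentalDomain b) = 1 := by
    rw [ZSpan.measure_fundamentalDomain b volume matrixUnitsBasis,
      volume_fundamentalDomain_matrixUnitsBasis, Basis.det_apply, hBT, Matrix.det_transpose, hdet]
    simp
  have hconv : Convex ℝ {N | meanRowNorm N < 1} := by
    simpa [Seminorm.ball_zero_eq] using meanRowNorm.convex_ball 0 1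
  have : Countable (Submodule.span ℤ (Set.range b)).toAddSubgroup :=
    inferInstanceAs (Countable (Submodule.span ℤ (Set.range b)))
  obtain ⟨N, hN0, hN⟩ := exists_ne_zero_mem_lattice_of_measure_mul_two_pow_lt_measure
    (ZSpan.isAddFundamentalDomain' b volume)
    (fun x hx => by simpa [map_neg_eq_map] using hx) hconv (by
      have hfin : finrank ℝ (Fin 3 → Fin 3 → ℝ) = 9 := by simp [finrank_pi_fintype]
      rw [hvol, one_mul, hfin]
      exact two_pow_nine_lt_volume_meanRowNorm_lt_one)
  exact ⟨N, N.2, by simpa using hN0, hN⟩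

/-- Let `𝒪` be a subring of `Mat₃(ℝ)` which is the `ℤ`-span of matrices `M₁, …, M₉` forming
an `ℝ`-basis of `Mat₃(ℝ)`, such that the `9 × 9` matrix `B` whose `i`-th row lists the nine
entries of `Mᵢ` has `|det B| = 1`. Then `𝒪` contains a nonzero matrix of determinant `0`. -/
theorem stmt_13 (O : Subring (Matrix (Fin 3) (Fin 3) ℝ))
    (M : Fin 9 → Matrix (Fin 3) (Fin 3) ℝ)
    (hmem : ∀ i, M i ∈ O)
    (hli : LinearIndependent ℝ M)
    (hspan : Submodule.span ℝ (Set.range M) = ⊤)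
    (hO : ∀ x : Matrix (Fin 3) (Fin 3) ℝ, x ∈ O ↔ x ∈ Submodule.span ℤ (Set.range M))
    (B : Matrix (Fin 9) (Fin 9) ℝ)
    (hB : ∀ (s : Fin 9) (p : Fin 3 × Fin 3), B s (finProdFinEquiv p) = M s p.1 p.2)
    (hdet : |B.det| = 1) :
    ∃ N ∈ O, N ≠ 0 ∧ N.det = 0 := by
  let b : Basis (Fin 9) ℝ (Fin 3 → Fin 3 → ℝ) :=
    (Basis.mk hli hspan.ge).map (Matrix.ofLinearEquiv ℝ).symm
  have hb : ∀ s, b s = M s := fun s => by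
    simp [b]
    rfl
  obtain ⟨N, hN, hN0, hlt⟩ := exists_mem_span_meanRowNorm_lt_one b B
    (fun s p => by rw [hB, hb]) hdet
  have hNO : Matrix.of N ∈ O := by
    rw [hO]
    rw [show ⇑b = M from funext hb] at hN
    exact hN
  refine ⟨Matrix.of N, hNO, hN0, ?_⟩
  obtain ⟨n, hn⟩ := exists_int_det_pow_three M B hB (by
    rintro h
    simp [h] at hdet) (Matrix.of N) fun s => (hO _).1 (O.mul_mem hNO (hmem s))
  have hn1 : |(n : ℝ)| < 1 := by
    rw [← hn, abs_pow]
    exact pow_lt_one₀ (abs_nonneg _) (abs_det_lt_one_of_sum_norm_row_lt N hlt) three_ne_zero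
  have hn0 : n = 0 := Int.abs_lt_one_iff.1 (by exact_mod_cast hn1)
  simpa [hn0] using hn
end
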